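/- arXiv:1904.10659 — 3 statements merged into one kernel-verified Lean document; each statement's English description precedes it below -/
import Mathlib

section
/- Let k be a field, let B and C be Hopf algebras over k, and let f : B → C be a homomorphism of bialgebras over k (corresponding to a morphism of affine k-group schemes u : H → G, where B = O(G) and C = O(H)). Assume that the image f(B) ⊆ C is finite-dimensional over k. Then C is a faithfully flat B-module (via the ring homomorphism f) if and only if the invariant subspace B^H = { b ∈ B : (id_B ⊗ f)(Δ_B(b)) = b ⊗ 1 } is exactly the line k·1_B (equivalently, dim_k B^H = 1). -/
open scoped TensorProduct
open Coalgebra HopfAlgebra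

namespace HopfAlgebra

section Antipode

variable {k A C : Type*} [CommRing k] [CommRing A] [HopfAlgebra k A] [CommRing C] [HopfAlgebra k C]

/-- In a commutative Hopf algebra the antipode is an involution. -/
lemma antipode_antipode_apply (a : A) : antipode k (antipode k a) = a := by
  have h : ((WithConv.toConv (AlgHom.id k A))⁻¹)⁻¹ = WithConv.toConv (AlgHom.id k A) := inv_inv _
  exact congr($h a)

/-- Bialgebra homomorphisms between commutative Hopf algebras preserve the antipode. -/
lemma map_antipode_apply (f : A →ₐc[k] C) (a : A) :
    f (antipode k a) = antipode k (f a) := by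
  have h : (WithConv.toConv (f : A →ₐ[k] C))⁻¹ =
      WithConv.toConv ((antipodeAlgHom k C).comp (f : A →ₐ[k] C)) := by
    refine inv_eq_of_mul_eq_one_left ?_
    have := AlgHom.convMul_comp_bialgHom_distrib (WithConv.toConv (antipodeAlgHom k C))
      (WithConv.toConv (AlgHom.id k C)) f
    rw [AlgHom.antipode_id_cancel] at this
    apply WithConv.ofConv_injective
    refine this.symm.trans ?_
    ext a
    simp [AlgHom.convOne_def]
  exact congr($h a)

lemma comp_antipode_convMul {D : Type*} [CommRing D] [Algebra k D] (g : A →ₐ[k] D) :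
    WithConv.toConv (g.comp (antipodeAlgHom k A)) * WithConv.toConv g = 1 := by
  have := AlgHom.comp_convMul_distrib g (WithConv.toConv (antipodeAlgHom k A))
    (WithConv.toConv (AlgHom.id k A))
  rw [AlgHom.antipode_id_cancel] at this
  apply WithConv.ofConv_injective
  refine this.symm.trans ?_
  ext a
  simp [AlgHom.convOne_def]

/-- `1 ⊗ a = ∑ (S a₁ ⊗ 1) Δ(a₂)`. -/
lemma sum_antipode_tmul_one_mul_comul {ι : Type*} {a : A} (r : Repr k a ι) :
    ∑ i ∈ r.index, (antipode k (r.left i) ⊗ₜ[k] (1 : A)) * comul (r.right i) = 1 ⊗ₜ a := by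
  have h : WithConv.toConv (Bialgebra.comulAlgHom k A) =
      WithConv.toConv (Algebra.TensorProduct.includeLeft : A →ₐ[k] A ⊗[k] A) *
        WithConv.toConv (Algebra.TensorProduct.includeRight : A →ₐ[k] A ⊗[k] A) := by
    apply WithConv.ofConv_injective
    ext a
    simp only [AlgHom.convMul_def]
    conv_lhs => simp [← (ℛ k a).eq]
    conv_rhs => simp [← (ℛ k a).eq]
  have h2 := congr(WithConv.toConv ((Algebra.TensorProduct.includeLeft : A →ₐ[k] A ⊗[k] A).comp
    (antipodeAlgHom k A)) * $h)
  rw [← mul_assoc, comp_antipode_convMul, one_mul] at h2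
  have h3 := congr($h2 a)
  rw [AlgHom.convMul_apply, ← r.eq] at h3
  simpa using h3

/-- `a ⊗ 1 = ∑ ((id ⊗ S) Δ(a₁)) (1 ⊗ a₂)`, for an arbitrary expansion of `Δ(a)`. -/
lemma sum_lTensor_antipode_comul_mul {ι : Type*} {a : A} (r : Repr k a ι) :
    ∑ i ∈ r.index, (antipode k).lTensor A (comul (r.left i)) * ((1 : A) ⊗ₜ[k] r.right i) =
      a ⊗ₜ 1 := by
  have h : WithConv.toConv ((Algebra.TensorProduct.map (AlgHom.id k A) (antipodeAlgHom k A)).comp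
        (Bialgebra.comulAlgHom k A)) =
      WithConv.toConv (Algebra.TensorProduct.includeLeft : A →ₐ[k] A ⊗[k] A) *
        WithConv.toConv ((Algebra.TensorProduct.includeRight : A →ₐ[k] A ⊗[k] A).comp
          (antipodeAlgHom k A)) := by
    apply WithConv.ofConv_injective
    ext a
    rw [AlgHom.convMul_def]
    simp only [AlgHom.comp_apply, Bialgebra.comulAlgHom_apply, ← (ℛ k a).eq, map_sum]
    refine Finset.sum_congr rfl fun i _ => ?_
    simp [antipodeAlgHom]
  have h2 := congr($h * WithConv.toConv
    (Algebra.TensorProduct.includeRight : A →ₐ[k] A ⊗[k] A))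
  rw [mul_assoc, comp_antipode_convMul, mul_one] at h2
  have h3 := congr($h2 a)
  rw [AlgHom.convMul_apply, ← r.eq] at h3
  simp only [map_sum] at h3
  exact h3

end Antipode

section Contract

variable {k : Type*} [CommRing k]

/-- The map `M ⊗ N → M` contracting the second factor with a linear form. -/
noncomputable def contractRight (M : Type*) {N : Type*} [AddCommGroup M] [Module k M]
    [AddCommGroup N] [Module k N] (p : N →ₗ[k] k) : M ⊗[k] N →ₗ[k] M :=
  TensorProduct.rid k M ∘ₗ p.lTensor M

variable {M N : Type*} [AddCommGroup M] [Module k M] [AddCommGroup N] [Module k N]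

@[simp]
lemma contractRight_tmul (p : N →ₗ[k] k) (m : M) (n : N) :
    contractRight M p (m ⊗ₜ n) = p n • m := by
  simp [contractRight]

variable {A : Type*} [CommRing A] [Bialgebra k A]

lemma contractRight_counit_comul (a : A) :
    contractRight A (counit (R := k)) (comul a) = a := by
  change TensorProduct.rid k A (counit.lTensor A (comul a)) = a
  simp

lemma counit_contractRight_comul (p : A →ₗ[k] k) (a : A) :
    counit (R := k) (contractRight A p (comul a)) = p a := by
  have h : counit ∘ₗ contractRight A p =
      p ∘ₗ (TensorProduct.lid k A).toLinearMap ∘ₗ (counit (R := k)).rTensor A := by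
    ext; simp [mul_comm]
  refine congr($h (comul a)).trans ?_
  simp

/-- `Δ(a₁ p(a₂)) = a₁ ⊗ a₂ p(a₃)`. -/
lemma comul_contractRight_comul (p : A →ₗ[k] k) (a : A) :
    comul (R := k) (contractRight A p (comul a)) =
      (contractRight A p ∘ₗ comul).lTensor A (comul a) := by
  have h : (comul (R := k)) ∘ₗ contractRight A p =
      (contractRight A p).lTensor A ∘ₗ (TensorProduct.assoc k A A A).toLinearMap ∘ₗ
        (comul (R := k)).rTensor A := by
    apply TensorProduct.ext'
    intro x y
    have : ∀ z : A ⊗[k] A, p y • z = (contractRight A p).lTensor A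
        ((TensorProduct.assoc k A A A) (z ⊗ₜ y)) := by
      intro z
      induction z with
      | zero => simp
      | add x y hx hy => simp only [smul_add, hx, hy, TensorProduct.add_tmul, map_add]
      | tmul u v => simp
    simpa using this (comul x)
  refine congr($h (comul a)).trans ?_
  simp [LinearMap.lTensor_comp]

lemma contractRight_left_mul {A : Type*} [CommRing A] [Algebra k A] (p : A →ₗ[k] k) (a : A)
    (z : A ⊗[k] A) :
    contractRight A p ((a ⊗ₜ 1) * z) = a * contractRight A p z := by
  induction z with
  | zero => simp
  | add x y hx hy => simp only [mul_add, hx, hy, map_add]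
  | tmul u v => simp

lemma contractRight_right_mul {A : Type*} [CommRing A] [Algebra k A] (p : A →ₗ[k] k) (a : A)
    (z : A ⊗[k] A) :
    contractRight A p ((1 ⊗ₜ a) * z) = contractRight A (p ∘ₗ LinearMap.mulLeft k a) z := by
  induction z with
  | zero => simp
  | add x y hx hy => simp only [mul_add, hx, hy, map_add]
  | tmul u v => simp

end Contract

section Integral

variable {k : Type*} [Field k] {A : Type*} [CommRing A] [HopfAlgebra k A]

/-- Every maximal ideal of an Artinian commutative ring is the annihilator of an element. -/
lemma _root_.IsArtinianRing.exists_ne_zero_mul_eq_zero {R : Type*} [CommRing R] [IsArtinianRing R]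
    (m : Ideal R) [m.IsMaximal] : ∃ t : R, t ≠ 0 ∧ ∀ a ∈ m, a * t = 0 := by
  have hm : m ∈ associatedPrimes R R := by
    apply Module.associatedPrimes.minimalPrimes_annihilator_subset_associatedPrimes
    refine ⟨⟨inferInstance, by simp [Module.annihilator_eq_bot.mpr inferInstance]⟩,
      fun q hq hqm => ?_⟩
    have := hq.1
    exact (IsArtinianRing.isMaximal_of_isPrime q |>.eq_of_le (Ideal.IsPrime.ne_top') hqm).ge
  obtain ⟨hp, t, ht⟩ := (isAssociatedPrime_iff_exists_injective_linearMap _ _).mp hm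
  refine ⟨t (Ideal.Quotient.mk m 1), ?_, fun a ha => ?_⟩
  · rw [Ne, map_eq_zero_iff _ ht, Ideal.Quotient.eq_zero_iff_mem]
    exact fun h => hp.ne_top ((Ideal.eq_top_iff_one m).mpr h)
  · rw [← smul_eq_mul, ← map_smul]
    convert map_zero t
    rw [← Ideal.Quotient.mk_eq_mk, ← Submodule.Quotient.mk_smul]
    exact Ideal.Quotient.eq_zero_iff_mem.mpr (by simpa using ha)

variable (k A) in
/-- A finite-dimensional commutative Hopf algebra contains a nonzero integral. -/
lemma exists_integral [FiniteDimensional k A] :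
    ∃ t : A, t ≠ 0 ∧ ∀ a : A, a * t = counit (R := k) a • t := by
  have : IsArtinianRing A := IsArtinianRing.of_finite k A
  have hs : Function.Surjective (Bialgebra.counitAlgHom k A) := Bialgebra.counit_surjective
  have := RingHom.ker_isMaximal_of_surjective (Bialgebra.counitAlgHom k A) hs
  obtain ⟨t, ht, h⟩ := IsArtinianRing.exists_ne_zero_mul_eq_zero
    (RingHom.ker (Bialgebra.counitAlgHom k A))
  refine ⟨t, ht, fun a => ?_⟩
  have := h (a - algebraMap k A (counit a)) (by simp [RingHom.mem_ker])
  rw [sub_mul, sub_eq_zero] at this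
  rw [this, Algebra.smul_def]

/-- `t₁ ⊗ a t₂ = S(a) t₁ ⊗ t₂` for an integral `t`. -/
lemma one_tmul_mul_comul_integral {t : A} (ht : ∀ a : A, a * t = counit (R := k) a • t) (a : A) :
    (1 ⊗ₜ[k] a) * comul t = (antipode k a ⊗ₜ[k] (1 : A)) * comul t := by
  conv_lhs => rw [← sum_antipode_tmul_one_mul_comul (ℛ k a), Finset.sum_mul]
  simp_rw [mul_assoc, ← Bialgebra.comul_mul, ht, map_smul, mul_smul_comm, ← smul_mul_assoc,
    ← Finset.sum_mul, TensorProduct.smul_tmul', ← TensorProduct.sum_tmul]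
  congr 2
  conv_rhs => rw [← contractRight_counit_comul (k := k) a, ← (ℛ k a).eq]
  simp

lemma contractRight_comul_integral_injective [FiniteDimensional k A] {t : A} (ht0 : t ≠ 0)
    (ht : ∀ a : A, a * t = counit (R := k) a • t) {p : A →ₗ[k] k}
    (hp : contractRight A p (comul t) = 0) : p = 0 := by
  let b := Module.finBasis k A
  obtain ⟨w, hw⟩ : ∃ w : Fin (Module.finrank k A) → A, ∑ i, b i ⊗ₜ[k] w i = comul t := by
    refine ⟨TensorProduct.equivFinsuppOfBasisLeft b (comul t), ?_⟩
    conv_rhs => rw [← (TensorProduct.equivFinsuppOfBasisLeft b).symm_apply_apply (comul t),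
      TensorProduct.equivFinsuppOfBasisLeft_symm_apply, Finsupp.sum_fintype _ _ (by simp)]
  have hpw (a : A) (i) : p (a * w i) = 0 := by
    have h1 := contractRight_right_mul p a (comul t)
    rw [one_tmul_mul_comul_integral ht, contractRight_left_mul, hp, mul_zero, ← hw] at h1
    simp only [map_sum, contractRight_tmul, LinearMap.comp_apply, LinearMap.mulLeft_apply] at h1
    exact Fintype.linearIndependent_iff.mp b.linearIndependent _ h1.symm i
  have hz (i) (z : A ⊗[k] A) : contractRight A p (z * (1 ⊗ₜ w i)) = 0 := by
    induction z with
    | zero => simp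
    | add x y hx hy => simp [add_mul, hx, hy]
    | tmul u v => simp [hpw]
  let r : Repr k t (Fin (Module.finrank k A)) := ⟨Finset.univ, b, w, hw⟩
  ext a
  have h1 := congr(contractRight A p ((1 ⊗ₜ a) * $(sum_lTensor_antipode_comul_mul r)))
  rw [Finset.mul_sum, map_sum, Finset.sum_eq_zero fun i _ => by rw [← mul_assoc]; exact hz i _]
    at h1
  have h2 : p a • t = 0 := by simpa using h1.symm
  exact (smul_eq_zero.mp h2).resolve_right ht0

/-- A nonzero integral `t` of a finite-dimensional commutative Hopf algebra is normalised by an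
integral `l` of the dual: `l t = 1` and `a₁ l(a₂) = l(a)`. -/
lemma exists_dual_integral [FiniteDimensional k A] {t : A} (ht0 : t ≠ 0)
    (ht : ∀ a : A, a * t = counit (R := k) a • t) :
    ∃ l : A →ₗ[k] k, l t = 1 ∧ ∀ a : A, contractRight A l (comul a) = l a • 1 := by
  let T : (A →ₗ[k] k) →ₗ[k] A :=
    { toFun p := contractRight A p (comul t)
      map_add' p q := by
        rw [← (ℛ k t).eq]; simp [add_smul, Finset.sum_add_distrib]
      map_smul' c p := by
        rw [← (ℛ k t).eq]; simp [mul_smul, Finset.smul_sum] }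
  have hT : Function.Injective T := (injective_iff_map_eq_zero T).mpr fun p hp =>
    contractRight_comul_integral_injective ht0 ht hp
  obtain ⟨l, hl⟩ := (LinearMap.injective_iff_surjective_of_finrank_eq_finrank
    (Subspace.dual_finrank_eq (K := k) (V := A))).mp hT 1
  change contractRight A l (comul t) = 1 at hl
  refine ⟨l, ?_, fun a => ?_⟩
  · rw [← counit_contractRight_comul, hl]; simp
  · rw [← sub_eq_zero, ← Module.forall_dual_apply_eq_zero_iff k]
    intro q
    let d : A →ₗ[k] A := contractRight A l ∘ₗ comul - l.smulRight 1
    have hd : d.lTensor A (comul t) = 0 := by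
      rw [LinearMap.lTensor_sub, LinearMap.sub_apply, ← comul_contractRight_comul, hl,
        Bialgebra.comul_one, sub_eq_zero, Algebra.TensorProduct.one_def]
      have hs : (l.smulRight (1 : A)).lTensor A =
          (TensorProduct.mk k A A).flip 1 ∘ₗ contractRight A l := by
        apply TensorProduct.ext'; intros; simp
      simp [hs, hl]
    have h0 : q ∘ₗ d = 0 := by
      refine contractRight_comul_integral_injective ht0 ht ?_
      have : contractRight A (q ∘ₗ d) = contractRight A q ∘ₗ d.lTensor A := by
        apply TensorProduct.ext'; intros; simp
      rw [this, LinearMap.comp_apply, hd, map_zero]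
    exact congr($h0 a)

end Integral

section Main

variable {k : Type*} [Field k] {A B C : Type*} [CommRing A] [CommRing B] [CommRing C]
  [HopfAlgebra k A] [HopfAlgebra k B] [HopfAlgebra k C]

/-- A surjection onto a finite-dimensional Hopf algebra with only constant invariants is
injective. -/
lemma injective_of_invariants_of_surjective [FiniteDimensional k A] (g : B →ₐc[k] A)
    (hg : Function.Surjective g)
    (hinv : ∀ b : B, (g : B →ₗ[k] A).lTensor B (comul b) = b ⊗ₜ 1 →
      b ∈ Set.range (algebraMap k B)) :
    Function.Injective g := by
  obtain ⟨t, ht0, ht⟩ := exists_integral k A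
  obtain ⟨l, hlt, hl⟩ := exists_dual_integral ht0 ht
  obtain ⟨y, hy⟩ := hg t
  let m : B →ₗ[k] k := l ∘ₗ (g : B →ₗ[k] A)
  have hm (x : B) : contractRight B m (comul x) = algebraMap k B (m x) := by
    have hd : (g : B →ₗ[k] A) ∘ₗ contractRight B m ∘ₗ comul = m.smulRight 1 := by
      have h1 : (g : B →ₗ[k] A) ∘ₗ contractRight B m =
          contractRight A l ∘ₗ TensorProduct.map (g : B →ₗ[k] A) (g : B →ₗ[k] A) := by
        apply TensorProduct.ext'; intros; simp [m]
      ext b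
      have h2 : TensorProduct.map (g : B →ₗ[k] A) (g : B →ₗ[k] A) (comul b) = comul (g b) :=
        CoalgHomClass.map_comp_comul_apply g b
      rw [← LinearMap.comp_assoc, h1, LinearMap.comp_apply, LinearMap.comp_apply, h2, hl]
      rfl
    have hs : (m.smulRight (1 : A)).lTensor B =
        (TensorProduct.mk k B A).flip 1 ∘ₗ contractRight B m := by
      apply TensorProduct.ext'; intros; simp
    obtain ⟨c, hc⟩ := hinv (contractRight B m (comul x)) (by
      rw [comul_contractRight_comul, ← LinearMap.comp_apply, ← LinearMap.lTensor_comp, hd, hs]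
      rfl)
    have := congr(counit (R := k) $hc)
    rw [counit_contractRight_comul, Bialgebra.counit_algebraMap] at this
    rw [← hc, this]
  refine (injective_iff_map_eq_zero g).mpr fun b hb => ?_
  have h1 := congr(contractRight B m ($(sum_antipode_tmul_one_mul_comul (ℛ k y)) * comul b))
  rw [Finset.sum_mul, map_sum, contractRight_right_mul, Finset.sum_eq_zero] at h1
  · have h2 : m ∘ₗ LinearMap.mulLeft k y = counit := by
      ext x
      simp only [m, LinearMap.comp_apply, LinearMap.mulLeft_apply]
      change l (g (y * x)) = _
      rw [map_mul, hy, mul_comm, ht, map_smul, hlt, smul_eq_mul, mul_one]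
      exact CoalgHomClass.counit_comp_apply g x
    rw [h2, contractRight_counit_comul] at h1
    exact h1.symm
  · intro i _
    rw [mul_assoc, ← Bialgebra.comul_mul, contractRight_left_mul, hm]
    have : m ((ℛ k y).right i * b) = 0 := by
      change l (g (_ * b)) = 0
      simp [hb]
    simp [this]

/-- If the image of `f` is finite-dimensional and `f` has only constant invariants, then `f` is
injective. -/
lemma injective_of_invariants (f : B →ₐc[k] C)
    (hfin : FiniteDimensional k (LinearMap.range (f : B →ₗ[k] C)))
    (hinv : ∀ b : B, (f : B →ₗ[k] C).lTensor B (comul b) = b ⊗ₜ 1 →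
      b ∈ Set.range (algebraMap k B)) :
    Function.Injective f := by
  let I : Ideal B := RingHom.ker (f : B →ₐ[k] C)
  have hI (b : B) : b ∈ I ↔ f b = 0 := RingHom.mem_ker
  let j : B ⧸ I →ₗ[k] C := (Ideal.kerLiftAlg (f : B →ₐ[k] C)).toLinearMap
  have hj : Function.Injective j := Ideal.kerLiftAlg_injective (f : B →ₐ[k] C)
  have : I.IsHopfIdeal k :=
    { counit_eq_zero x hx := by
        rw [← CoalgHomClass.counit_comp_apply f x, (hI x).mp hx, map_zero]
      map_mkQ_comul_eq_zero x hx := by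
        let j' : B ⧸ I.restrictScalars k →ₗ[k] C :=
          (I.restrictScalars k).liftQ (f : B →ₗ[k] C) fun b hb => (hI b).mp hb
        have hj' : Function.Injective j' := by
          rw [← LinearMap.ker_eq_bot]
          exact Submodule.ker_liftQ_eq_bot _ _ _ fun b hb => (hI b).mpr hb
        have hjj : Function.Injective (TensorProduct.map j' j') :=
          TensorProduct.map_injective_of_flat_flat _ _ hj' hj'
        refine (map_eq_zero_iff _ hjj).mp ?_
        have hj'q : j' ∘ₗ (I.restrictScalars k).mkQ = (f : B →ₗ[k] C) := rfl
        rw [TensorProduct.map_map, hj'q]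
        refine (CoalgHomClass.map_comp_comul_apply f x).trans ?_
        rw [(hI x).mp hx, map_zero]
      antipode_mem x hx := by
        rw [hI, map_antipode_apply, (hI x).mp hx, map_zero] }
  have hfd : FiniteDimensional k (B ⧸ I) := by
    refine Module.Finite.of_injective (j.codRestrict (LinearMap.range (f : B →ₗ[k] C)) ?_) ?_
    · intro x
      obtain ⟨b, rfl⟩ := Ideal.Quotient.mk_surjective x
      exact ⟨b, rfl⟩
    · exact fun x y h => hj (congrArg Subtype.val h)
  have hq := injective_of_invariants_of_surjective (Bialgebra.Quotient.mkBialgHom (R := k) I)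
    Ideal.Quotient.mk_surjective (fun b hb => hinv b ?_)
  · exact hj.comp hq
  · have h := congr(j.lTensor B $hb)
    rw [← LinearMap.comp_apply, ← LinearMap.lTensor_comp, LinearMap.lTensor_tmul] at h
    refine Eq.trans h ?_
    congr 1
    exact map_one (Ideal.kerLiftAlg (f : B →ₐ[k] C))

/-- Every linear map over a field has a generalised inverse. -/
lemma _root_.LinearMap.exists_apply_apply_apply_eq {V W : Type*} [AddCommGroup V] [Module k V]
    [AddCommGroup W] [Module k W] (m : V →ₗ[k] W) : ∃ s : W →ₗ[k] V, ∀ x, m (s (m x)) = m x := by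
  obtain ⟨s, hs⟩ := m.rangeRestrict.exists_rightInverse_of_surjective
    (LinearMap.range_rangeRestrict _)
  obtain ⟨s', hs'⟩ := s.exists_extend
  refine ⟨s', fun x => ?_⟩
  have h1 : m (s (m.rangeRestrict x)) = m x := congr(($hs (m.rangeRestrict x)).1)
  have h2 : s' (m x) = s (m.rangeRestrict x) := congr($hs' (m.rangeRestrict x))
  rw [h2, h1]

/-- An integral of a finite-dimensional Hopf subalgebra annihilates only elements of the
augmentation ideal. -/
lemma counit_eq_zero_of_integral_mul_eq_zero (f : B →ₐc[k] C) {t : B} (hft : f t ≠ 0)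
    (ht : ∀ a : B, a * t = counit (R := k) a • t) {c : C} (hc : f t * c = 0) :
    counit (R := k) c = 0 := by
  obtain ⟨s, hs⟩ := (LinearMap.mulLeft k (f t)).exists_apply_apply_apply_eq
  simp only [LinearMap.mulLeft_apply] at hs
  let F : C ⊗[k] C →ₗ[k] C := LinearMap.mul' k C ∘ₗ
    TensorProduct.map (LinearMap.mulLeft k (f t) ∘ₗ s) (antipode k)
  have hF (x y : C) : F (x ⊗ₜ y) = f t * s x * antipode k y := rfl
  have key (z : C ⊗[k] C) : F (comul (f t) * z) = F ((f t ⊗ₜ 1) * z) := by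
    induction z with
    | zero => simp
    | add x y hx hy => simp only [mul_add, map_add, hx, hy]
    | tmul x y =>
      have h1 : comul (R := k) (f t) =
          ∑ i ∈ (ℛ k t).index, f ((ℛ k t).left i) ⊗ₜ f ((ℛ k t).right i) := by
        refine (CoalgHomClass.map_comp_comul_apply f t).symm.trans ?_
        conv_lhs => rw [← (ℛ k t).eq]
        simp
      have h2 (a : B) : f t * antipode k (f a) = counit (R := k) a • f t := by
        rw [← map_antipode_apply, ← map_mul, mul_comm, ht, counit_antipode, map_smul]
      have h3 : f t = ∑ i ∈ (ℛ k t).index, counit (R := k) ((ℛ k t).right i) •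
          f ((ℛ k t).left i) := by
        conv_lhs => rw [← contractRight_counit_comul (k := k) t, ← (ℛ k t).eq]
        simp
      rw [h1, Finset.sum_mul, map_sum]
      simp only [Algebra.TensorProduct.tmul_mul_tmul, hF, antipode_mul_distrib, one_mul]
      conv_rhs => enter [1, 2, 2, 1]; rw [h3]
      rw [Finset.sum_mul, map_sum, Finset.mul_sum, Finset.sum_mul]
      refine Finset.sum_congr rfl fun i _ => ?_
      rw [smul_mul_assoc, map_smul, mul_smul_comm, ← smul_mul_assoc, ← h2]
      ring
  have h0 := key (comul c)
  rw [← Bialgebra.comul_mul, hc, map_zero, map_zero, ← (ℛ k c).eq, Finset.mul_sum, map_sum] at h0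
  simp only [Algebra.TensorProduct.tmul_mul_tmul, hF, one_mul, hs, mul_assoc] at h0
  rw [← Finset.mul_sum, sum_mul_antipode_eq_smul, mul_smul_comm, mul_one] at h0
  exact (smul_eq_zero.mp h0.symm).resolve_right hft

/-- A commutative Hopf algebra is projective over every finite-dimensional Hopf subalgebra. -/
lemma projective_of_injective [FiniteDimensional k B] (f : B →ₐc[k] C)
    (hf : Function.Injective f) :
    let : Algebra B C := ((f : B →ₐ[k] C) : B →+* C).toAlgebra
    Module.Projective B C := by
  let : Algebra B C := ((f : B →ₐ[k] C) : B →+* C).toAlgebra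
  have hsm (b : B) (c : C) : b • c = f b * c := rfl
  have : IsScalarTower k B C := .of_algebraMap_eq fun x => (AlgHom.commutes (f : B →ₐ[k] C) x).symm
  obtain ⟨t, ht0, ht⟩ := exists_integral k B
  have hft : f t ≠ 0 := (map_ne_zero_iff f hf).mpr ht0
  obtain ⟨q, hq⟩ : ∃ q : C →ₗ[k] k, ∀ c, q (f t * c) = counit c := by
    obtain ⟨s, hs⟩ := (LinearMap.mulLeft k (f t)).exists_apply_apply_apply_eq
    refine ⟨counit ∘ₗ s, fun c => ?_⟩
    rw [LinearMap.comp_apply, ← sub_eq_zero, ← map_sub]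
    refine counit_eq_zero_of_integral_mul_eq_zero f hft ht ?_
    rw [mul_sub, sub_eq_zero]
    exact hs c
  let φ : C →ₗ[k] C := contractRight C q ∘ₗ comul
  let r := ℛ k t
  let σ₀ : C →ₗ[k] B ⊗[k] C := ∑ i ∈ r.index,
    TensorProduct.mk k B C (antipode k (r.left i)) ∘ₗ φ ∘ₗ LinearMap.mulLeft k (f (r.right i))
  have hσ₀ (c : C) : σ₀ c = ∑ i ∈ r.index, antipode k (r.left i) ⊗ₜ φ (f (r.right i) * c) := by
    simp [σ₀]
  let σ : C →ₗ[B] B ⊗[k] C :=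
    { toFun := σ₀
      map_add' := map_add σ₀
      map_smul' b c := by
        let G : B ⊗[k] B →ₗ[k] B ⊗[k] C :=
          TensorProduct.map (antipode k) (φ ∘ₗ LinearMap.mulRight k c ∘ₗ (f : B →ₗ[k] C))
        have h := congr(G $(one_tmul_mul_comul_integral ht b))
        rw [← r.eq, Finset.mul_sum, Finset.mul_sum, map_sum, map_sum] at h
        rw [RingHom.id_apply, hσ₀, hσ₀, Finset.smul_sum]
        refine Eq.trans (Finset.sum_congr rfl fun i _ => ?_)
          (h.trans (Finset.sum_congr rfl fun i _ => ?_))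
        · simp [G, hsm, mul_assoc, mul_left_comm]
        · simp [G, antipode_mul_distrib, antipode_antipode_apply, TensorProduct.smul_tmul'] }
  let π : B ⊗[k] C →ₗ[B] C := (LinearMap.id : C →ₗ[k] C).liftBaseChange B
  refine Module.Projective.of_split σ π (LinearMap.ext fun c => ?_)
  change π (σ₀ c) = c
  rw [hσ₀, map_sum]
  let G : B ⊗[k] B →ₗ[k] C ⊗[k] C := TensorProduct.map (f : B →ₗ[k] C) (f : B →ₗ[k] C)
  have hG (x y : B ⊗[k] B) : G (x * y) = G x * G y :=
    map_mul (Algebra.TensorProduct.map (f : B →ₐ[k] C) (f : B →ₐ[k] C)) x y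
  have hG' (x : B) : G (comul x) = comul (f x) := CoalgHomClass.map_comp_comul_apply f x
  have h := congr(contractRight C q ((G $(sum_antipode_tmul_one_mul_comul r)) * comul c))
  rw [map_sum, Finset.sum_mul, map_sum] at h
  refine Eq.trans (Finset.sum_congr rfl fun i _ => ?_) (h.trans ?_)
  · rw [hG, hG', mul_assoc, ← Bialgebra.comul_mul]
    refine Eq.trans ?_ ((contractRight_left_mul q (f (antipode k (r.left i)))
      (comul (f (r.right i) * c))).symm.trans ?_)
    · simp [π, φ, hsm]
    · simp [G]
  · have h1 : G (1 ⊗ₜ t) = 1 ⊗ₜ f t := by simp [G]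
    have h2 : q ∘ₗ LinearMap.mulLeft k (f t) = counit := LinearMap.ext hq
    rw [h1, contractRight_right_mul, h2, contractRight_counit_comul]

end Main
end HopfAlgebra

/-- Let `f : B → C` be a bialgebra homomorphism between Hopf algebras over
a field `k` whose image is finite-dimensional. Then `C` is faithfully flat over `B`
(via `f`) if and only if the invariants `B^H = {b | (id ⊗ f)(Δ b) = b ⊗ 1}` are exactly
the constants `k·1_B`. -/
theorem stmt0 (k : Type*) [Field k]
    (B C : Type*) [CommRing B] [CommRing C]
    [HopfAlgebra k B] [HopfAlgebra k C]
    (f : B →ₐc[k] C)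
    (hfin : FiniteDimensional k (LinearMap.range (f : B →ₗ[k] C))) :
    (letI : Algebra B C := ((f : B →ₐ[k] C) : B →+* C).toAlgebra;
      Module.FaithfullyFlat B C) ↔
    { b : B | TensorProduct.map (LinearMap.id : B →ₗ[k] B) (f : B →ₗ[k] C)
        (Coalgebra.comul b) = b ⊗ₜ[k] (1 : C) } =
      Set.range (algebraMap k B) := by
  let : Algebra B C := ((f : B →ₐ[k] C) : B →+* C).toAlgebra
  have hmap (c : k) : f (algebraMap k B c) = algebraMap k C c := AlgHom.commutes (f : B →ₐ[k] C) c
  constructor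
  · intro hff
    have : Module.FaithfullyFlat B C := hff
    have hf : Function.Injective f := FaithfulSMul.algebraMap_injective B C
    refine Set.Subset.antisymm (fun b hb => ⟨counit b, hf ?_⟩) ?_
    · have h := congr(TensorProduct.lid k C ((counit (R := k)).rTensor C $hb))
      have hc : (counit (R := k) (A := B)).rTensor C ∘ₗ (f : B →ₗ[k] C).lTensor B =
          (f : B →ₗ[k] C).lTensor k ∘ₗ counit.rTensor B := by
        apply TensorProduct.ext'; intros; simp
      have hc' := congr(TensorProduct.lid k C ($hc (comul b)))
      rw [LinearMap.comp_apply, LinearMap.comp_apply, rTensor_counit_comul] at hc'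
      have h' := hc'.symm.trans h
      simp only [LinearMap.lTensor_tmul, LinearMap.rTensor_tmul, TensorProduct.lid_tmul,
        one_smul] at h'
      rw [hmap, Algebra.algebraMap_eq_smul_one]
      exact h'.symm
    · rintro _ ⟨c, rfl⟩
      simp only [Set.mem_ofPred_eq, Bialgebra.comul_algebraMap,
        Algebra.TensorProduct.algebraMap_apply, TensorProduct.map_tmul, LinearMap.id_apply]
      congr 1
      exact map_one f
  · intro h
    have hf : Function.Injective f := injective_of_invariants f hfin fun b hb => h.subset hb
    have : FiniteDimensional k B :=
      Module.Finite.of_injective ((f : B →ₗ[k] C).rangeRestrict)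
        fun x y hxy => hf (congrArg Subtype.val hxy)
    have : Module.Projective B C := projective_of_injective f hf
    have : IsArtinianRing B := IsArtinianRing.of_finite k B
    refine { submodule_ne_top := fun m hm htop => ?_ }
    obtain ⟨t, ht0, ht⟩ := IsArtinianRing.exists_ne_zero_mul_eq_zero m
    have h1 : (1 : C) ∈ m • (⊤ : Submodule B C) := by rw [htop]; trivial
    have h2 : ∀ c ∈ m • (⊤ : Submodule B C), t • c = 0 := fun c hc =>
      Submodule.smul_induction_on hc
        (fun r hr n _ => by rw [smul_smul, mul_comm, ht r hr, zero_smul])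
        (fun x y hx hy => by rw [smul_add, hx, hy, add_zero])
    have h3 : f t * 1 = 0 := h2 1 h1
    rw [mul_one] at h3
    exact ht0 ((map_eq_zero_iff f hf).mp h3)
end

section
/- Let K be a field and Y a scheme equipped with a proper morphism f : Y → Spec K. Assume that Y is reduced, that the underlying topological space of Y is connected, and that f admits a section g : Spec K → Y (i.e., Y has a K-point). Then the canonical ring homomorphism K → Γ(Y, O_Y) induced by f is bijective; that is, H^0(Y, O_Y) = K. -/
open AlgebraicGeometry CategoryTheory Opposite

/-- An idempotent global section of a reduced connected scheme is `0` or `1`. -/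
theorem eq_zero_or_eq_one_of_isIdempotentElem (Y : Scheme) [IsReduced Y] [ConnectedSpace Y]
    {e : Γ(Y, ⊤)} (he : IsIdempotentElem e) : e = 0 ∨ e = 1 := by
  have hdisj : Y.basicOpen e ⊓ Y.basicOpen (1 - e) = ⊥ := by
    rw [← Scheme.basicOpen_mul, he.mul_one_sub_self, Scheme.basicOpen_zero]
  have hcover : Y.basicOpen e ⊔ Y.basicOpen (1 - e) = ⊤ := by
    have h := Y.basicOpen_add_le e (1 - e)
    rw [add_sub_cancel, Y.basicOpen_of_isUnit isUnit_one] at h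
    exact top_le_iff.mp h
  have hcompl : IsCompl (Y.basicOpen e : Set Y) (Y.basicOpen (1 - e)) := by
    refine ⟨disjoint_iff.mpr ?_, codisjoint_iff.mpr ?_⟩
    · exact congrArg (fun U : Y.Opens ↦ (U : Set Y)) hdisj
    · exact congrArg (fun U : Y.Opens ↦ (U : Set Y)) hcover
  have hclopen : IsClopen (Y.basicOpen e : Set Y) :=
    ⟨⟨hcompl.compl_eq ▸ (Y.basicOpen (1 - e)).isOpen⟩, (Y.basicOpen e).isOpen⟩
  rcases isClopen_iff.mp hclopen with h | h
  · left
    exact (basicOpen_eq_bot_iff e).mp (TopologicalSpace.Opens.ext h)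
  · right
    have h' : Y.basicOpen e = ⊤ := TopologicalSpace.Opens.ext h
    rw [h', top_inf_eq] at hdisj
    exact (sub_eq_zero.mp ((basicOpen_eq_bot_iff _).mp hdisj)).symm

/-- In a reduced algebra that is integral over a field and has only trivial idempotents,
every nonzero element is a unit. -/
theorem isUnit_of_isIntegral_of_idempotents_trivial {K A : Type*} [Field K] [CommRing A]
    [Algebra K A] [Algebra.IsIntegral K A] [_root_.IsReduced A]
    (hA : ∀ e : A, IsIdempotentElem e → e = 0 ∨ e = 1) {x : A} (hx : x ≠ 0) : IsUnit x := by
  have : Module.Finite K (Algebra.adjoin K {x}) :=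
    Module.Finite.iff_fg.mpr (Algebra.IsIntegral.isIntegral x).fg_adjoin_singleton
  have : IsArtinianRing (Algebra.adjoin K {x}) := IsArtinianRing.of_finite K _
  obtain ⟨n, y, hy⟩ := IsArtinian.exists_pow_succ_smul_dvd
    (⟨x, Algebra.self_mem_adjoin_singleton K x⟩ : Algebra.adjoin K {x})
    (1 : Algebra.adjoin K {x})
  have hxy : x ^ n * (x * (y : A)) = x ^ n := by
    have := congrArg Subtype.val hy
    simpa [pow_succ, mul_assoc] using this
  have hpow (k : ℕ) : x ^ n * (x * (y : A)) ^ k = x ^ n := by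
    induction k with
    | zero => simp
    | succ k ih => rw [pow_succ, ← mul_assoc, ih, hxy]
  have hidem : IsIdempotentElem ((x * (y : A)) ^ n) := by
    change (x * (y : A)) ^ n * (x * (y : A)) ^ n = _
    conv_lhs => enter [1]; rw [mul_pow, mul_comm]
    rw [mul_assoc, hpow, mul_comm, mul_pow]
  rcases hA _ hidem with h | h
  · have := hpow n
    rw [h, mul_zero] at this
    exact absurd (eq_zero_of_pow_eq_zero this.symm) hx
  · rcases n.eq_zero_or_pos with rfl | hn
    · exact .of_mul_eq_one (y : A) (by simpa using hxy)
    · exact isUnit_of_mul_isUnit_left ((isUnit_pow_iff hn.ne').mp (h ▸ isUnit_one))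

/-- A proper, reduced, connected scheme over a field `K` with a `K`-point
has only constant global sections: the canonical map `K → Γ(Y, O_Y)` is bijective. -/
theorem stmt2 (K : Type) [Field K] (Y : Scheme)
    (f : Y ⟶ Spec (CommRingCat.of K)) [IsProper f]
    [IsReduced Y] [ConnectedSpace Y]
    (g : Spec (CommRingCat.of K) ⟶ Y) (hg : g ≫ f = 𝟙 (Spec (CommRingCat.of K))) :
    Function.Bijective
      ((Scheme.ΓSpecIso (CommRingCat.of K)).inv ≫ Scheme.Γ.map f.op) := by
  let F : CommRingCat.of K ⟶ Γ(Y, ⊤) := (Scheme.ΓSpecIso (.of K)).inv ≫ f.appTop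
  let G : Γ(Y, ⊤) ⟶ CommRingCat.of K := g.appTop ≫ (Scheme.ΓSpecIso (.of K)).hom
  have hFG : F ≫ G = 𝟙 _ := by
    have : f.appTop ≫ g.appTop = 𝟙 _ := by
      rw [← Scheme.Hom.comp_appTop, hg, Scheme.Hom.id_appTop]
    simp [F, G, reassoc_of% this]
  have hGF (a : K) : G.hom (F.hom a) = a := congrArg (fun φ ↦ φ.hom a) hFG
  have hF : F.hom.IsIntegral := by
    apply RingHom.isIntegral_respectsIso.2 (e := (Scheme.ΓSpecIso _).symm.commRingCatIsoToRingEquiv)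
    exact isIntegral_appTop_of_universallyClosed f
  change Function.Bijective F.hom
  refine ⟨Function.LeftInverse.injective (g := G.hom) hGF, fun s ↦ ⟨G.hom s, ?_⟩⟩
  algebraize [F.hom]
  by_contra hne
  have hunit : IsUnit (F.hom (G.hom s) - s) :=
    isUnit_of_isIntegral_of_idempotents_trivial (K := K)
      (fun _ ↦ eq_zero_or_eq_one_of_isIdempotentElem Y) (sub_ne_zero.mpr hne)
  refine (hunit.map G.hom).ne_zero ?_
  rw [map_sub, hGF, sub_self]
end

section
/- Let K be a field and R a commutative K-algebra which is finite-dimensional as a K-vector space, is reduced, and has no idempotents other than 0 and 1. If there exists a K-algebra homomorphism R → K, then the structure homomorphism K → R is bijective (i.e., R = K). -/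
/-- An element of a reduced commutative Artinian ring is von Neumann regular. -/
theorem exists_eq_mul_mul_of_isReduced_of_isArtinianRing {R : Type*} [CommRing R] [IsReduced R]
    [IsArtinianRing R] (x : R) : ∃ y, x = x * (x * y) := by
  obtain ⟨n, y, h⟩ := IsArtinian.exists_pow_succ_smul_dvd x (1 : R)
  simp only [smul_eq_mul, mul_one, Nat.succ_eq_add_one] at h
  refine ⟨y, ?_⟩
  have hpow : (x * (1 - x * y)) ^ (n + 1) = 0 := by
    rw [mul_pow]
    linear_combination (-x * (1 - x * y) ^ n) * h
  linear_combination eq_zero_of_pow_eq_zero hpow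

/-- A finite-dimensional, reduced, connected (no nontrivial idempotents)
commutative algebra over a field `K` admitting a `K`-algebra homomorphism to `K`
is isomorphic to `K` via the structure map. -/
theorem stmt3 (K : Type*) [Field K] (R : Type*) [CommRing R] [Algebra K R]
    [FiniteDimensional K R] [IsReduced R]
    (hidem : ∀ e : R, e * e = e → e = 0 ∨ e = 1)
    (hpoint : Nonempty (R →ₐ[K] K)) :
    Function.Bijective (algebraMap K R) := by
  obtain ⟨φ⟩ := hpoint
  have : IsArtinianRing R := IsArtinianRing.of_finite K R
  have hφ : Function.Injective φ := by
    refine (injective_iff_map_eq_zero φ).2 fun x hx => ?_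
    obtain ⟨y, hy⟩ := exists_eq_mul_mul_of_isReduced_of_isArtinianRing x
    rcases hidem (x * y) (by linear_combination (-y) * hy) with he | he
    · rw [hy, he, mul_zero]
    · simpa [hx] using congrArg φ he
  exact ⟨Function.LeftInverse.injective (g := φ) φ.commutes,
    fun r => ⟨φ r, hφ (φ.commutes (φ r))⟩⟩
end
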